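/- arXiv:hep-th/9911030 — 2 statements merged into one kernel-verified Lean document; each statement's English description precedes it below -/
import Mathlib

section
/- Let λ, μ ∈ ℂ be such that sinh(λ − μ + η) ≠ 0 and sinh(λ − ξ_n + η) ≠ 0, sinh(μ − ξ_n + η) ≠ 0 for every 1 ≤ n ≤ N. Then the inhomogeneous XXZ monodromy matrix satisfies the RTT relation R_{12}(λ,μ) T_1(λ) T_2(μ) = T_2(μ) T_1(λ) R_{12}(λ,μ) as operators on ℂ²_1 ⊗ ℂ²_2 ⊗ H, where T_1(λ) acts on the first auxiliary copy of ℂ² and H, T_2(μ) acts on the second auxiliary copy and H, and R_{12} acts on the two auxiliary copies. -/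
open Matrix Complex

noncomputable section

/-- The 4×4 R-matrix on ℂ² ⊗ ℂ² with parameters `b`, `c`, in the ordered basis
(e₁⊗e₁, e₁⊗e₂, e₂⊗e₁, e₂⊗e₂) given by [[1,0,0,0],[0,b,c,0],[0,c,b,0],[0,0,0,1]]. -/
def Rmat (b c : ℂ) : Matrix (Fin 2 × Fin 2) (Fin 2 × Fin 2) ℂ :=
  Matrix.of fun p q =>
    if p = q then (if p.1 = p.2 then 1 else b)
    else if p.1 = q.2 ∧ p.2 = q.1 then c else 0

/-- The trigonometric (XXZ) R-matrix, with b(λ,μ) = sinh(λ−μ)/sinh(λ−μ+η),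
c(λ,μ) = sinh(η)/sinh(λ−μ+η). -/
def Rxxz (η lam mu : ℂ) : Matrix (Fin 2 × Fin 2) (Fin 2 × Fin 2) ℂ :=
  Rmat (Complex.sinh (lam - mu) / Complex.sinh (lam - mu + η))
       (Complex.sinh η / Complex.sinh (lam - mu + η))

variable {N : ℕ}

/-- Embedding of an operator on ℂ²(aux) ⊗ ℂ²(site n) into (aux) ⊗ H, H = ⊗ⁿ ℂ². -/
def embS (n : Fin N) (M : Matrix (Fin 2 × Fin 2) (Fin 2 × Fin 2) ℂ) :
    Matrix (Fin 2 × (Fin N → Fin 2)) (Fin 2 × (Fin N → Fin 2)) ℂ :=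
  Matrix.of fun p q =>
    M (p.1, p.2 n) (q.1, q.2 n) *
      ∏ j : Fin N, if j = n then 1 else (if p.2 j = q.2 j then 1 else 0)

/-- The inhomogeneous XXZ monodromy matrix `T₀(λ) = R₀N(λ,ξ_N) ⋯ R₀1(λ,ξ_1)`. -/
def Tmon (η : ℂ) (ξ : Fin N → ℂ) (lam : ℂ) :
    Matrix (Fin 2 × (Fin N → Fin 2)) (Fin 2 × (Fin N → Fin 2)) ℂ :=
  ((List.ofFn fun n : Fin N => embS n (Rxxz η lam (ξ n))).reverse).prod

/-- The operator entry `T_{ε,ε'}(λ)` of the monodromy matrix, so that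
`T₁₁ = A`, `T₁₂ = B`, `T₂₁ = C`, `T₂₂ = D`. -/
def blkT (η : ℂ) (ξ : Fin N → ℂ) (ε ε' : Fin 2) (lam : ℂ) :
    Matrix (Fin N → Fin 2) (Fin N → Fin 2) ℂ :=
  Matrix.of fun x y => Tmon η ξ lam (ε, x) (ε', y)

/-- The transfer matrix `t(λ) = A(λ) + D(λ)`. -/
def tT (η : ℂ) (ξ : Fin N → ℂ) (lam : ℂ) : Matrix (Fin N → Fin 2) (Fin N → Fin 2) ℂ :=
  blkT η ξ 0 0 lam + blkT η ξ 1 1 lam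

/-- The operator acting as `M` on the `n`-th tensor factor of H and as the identity elsewhere. -/
def embH (n : Fin N) (M : Matrix (Fin 2) (Fin 2) ℂ) :
    Matrix (Fin N → Fin 2) (Fin N → Fin 2) ℂ :=
  Matrix.of fun x y =>
    M (x n) (y n) * ∏ j : Fin N, if j = n then 1 else (if x j = y j then 1 else 0)

/-- The ordered product `∏_{i=1}^{n} (A+D)(ξ_i)` of transfer matrices. -/
def prodT (η : ℂ) (ξ : Fin N → ℂ) (n : ℕ) (h : n ≤ N) :
    Matrix (Fin N → Fin 2) (Fin N → Fin 2) ℂ :=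
  (List.ofFn fun i : Fin n => tT η ξ (ξ (Fin.castLE h i))).prod

/-- Embedding of a two-leg operator into legs 1,2 of a three-fold tensor product. -/
def e12 {α β γ : Type*} [DecidableEq γ]
    (M : Matrix (α × β) (α × β) ℂ) : Matrix (α × β × γ) (α × β × γ) ℂ :=
  Matrix.of fun p q => M (p.1, p.2.1) (q.1, q.2.1) * (if p.2.2 = q.2.2 then 1 else 0)

/-- Embedding of a two-leg operator into legs 1,3 of a three-fold tensor product. -/
def e13 {α β γ : Type*} [DecidableEq β]
    (M : Matrix (α × γ) (α × γ) ℂ) : Matrix (α × β × γ) (α × β × γ) ℂ :=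
  Matrix.of fun p q => M (p.1, p.2.2) (q.1, q.2.2) * (if p.2.1 = q.2.1 then 1 else 0)

/-- Embedding of a two-leg operator into legs 2,3 of a three-fold tensor product. -/
def e23 {α β γ : Type*} [DecidableEq α]
    (M : Matrix (β × γ) (β × γ) ℂ) : Matrix (α × β × γ) (α × β × γ) ℂ :=
  Matrix.of fun p q => M (p.2.1, p.2.2) (q.2.1, q.2.2) * (if p.1 = q.1 then 1 else 0)

/-- Embedding of an operator on (two auxiliary copies) ⊗ (site n) into (two auxiliary copies) ⊗ H. -/
def embSite {N : ℕ} (n : Fin N)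
    (M : Matrix (Fin 2 × Fin 2 × Fin 2) (Fin 2 × Fin 2 × Fin 2) ℂ) :
    Matrix (Fin 2 × Fin 2 × (Fin N → Fin 2)) (Fin 2 × Fin 2 × (Fin N → Fin 2)) ℂ :=
  Matrix.of fun p q =>
    M (p.1, p.2.1, p.2.2 n) (q.1, q.2.1, q.2.2 n) *
      ∏ j : Fin N, if j = n then 1 else (if p.2.2 j = q.2.2 j then 1 else 0)

theorem prod_ite_off {N : ℕ} (n : Fin N) (x y : Fin N → Fin 2) :
    (∏ j : Fin N, if j = n then (1 : ℂ) else (if x j = y j then 1 else 0)) =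
      if ∀ j, j ≠ n → x j = y j then 1 else 0 := by
  have : ∀ j, (if j = n then (1 : ℂ) else (if x j = y j then 1 else 0)) =
      if j ≠ n → x j = y j then 1 else 0 := by
    intro j; by_cases h : j = n <;> simp [h]
  simp only [this]
  rw [Finset.prod_ite_zero]
  simp

theorem e13_mul {α β γ : Type*} [Fintype α] [Fintype β] [Fintype γ] [DecidableEq β]
    (A B : Matrix (α × γ) (α × γ) ℂ) :
    e13 (β := β) (A * B) = e13 A * e13 B := by
  ext ⟨a, b, c⟩ ⟨a', b', c'⟩
  simp only [e13, Matrix.mul_apply, Matrix.of_apply, Fintype.sum_prod_type, Finset.sum_mul]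
  refine Finset.sum_congr rfl fun i _ => ?_
  rw [Finset.sum_eq_single b (by intro k _ hk; simp [hk.symm]) (by simp)]
  simp

theorem e23_mul {α β γ : Type*} [Fintype α] [Fintype β] [Fintype γ] [DecidableEq α]
    (A B : Matrix (β × γ) (β × γ) ℂ) :
    e23 (α := α) (A * B) = e23 A * e23 B := by
  ext ⟨a, b, c⟩ ⟨a', b', c'⟩
  simp only [e23, Matrix.mul_apply, Matrix.of_apply, Fintype.sum_prod_type, Finset.sum_mul]
  symm
  rw [Finset.sum_eq_single a (by intro k _ hk; simp [hk.symm]) (by simp)]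
  simp

theorem e13_one {α β γ : Type*} [DecidableEq α] [DecidableEq β] [DecidableEq γ] :
    e13 (β := β) (1 : Matrix (α × γ) (α × γ) ℂ) = 1 := by
  ext ⟨a, b, c⟩ ⟨a', b', c'⟩
  simp only [e13, Matrix.of_apply, Matrix.one_apply, Prod.mk.injEq, ← ite_and, mul_ite, mul_one,
    mul_zero]
  congr 1
  grind

theorem e23_one {α β γ : Type*} [DecidableEq α] [DecidableEq β] [DecidableEq γ] :
    e23 (α := α) (1 : Matrix (β × γ) (β × γ) ℂ) = 1 := by
  ext ⟨a, b, c⟩ ⟨a', b', c'⟩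
  simp only [e23, Matrix.of_apply, Matrix.one_apply, Prod.mk.injEq, ← ite_and, mul_ite, mul_one,
    mul_zero]

theorem e13_list_prod {α β γ : Type*} [Fintype α] [Fintype β] [Fintype γ] [DecidableEq α]
    [DecidableEq β] [DecidableEq γ] (l : List (Matrix (α × γ) (α × γ) ℂ)) :
    e13 (β := β) l.prod = (l.map (e13 (β := β))).prod := by
  induction l with
  | nil => simp [e13_one]
  | cons A l ih => simp [e13_mul, ih]

theorem e23_list_prod {α β γ : Type*} [Fintype α] [Fintype β] [Fintype γ] [DecidableEq α]
    [DecidableEq β] [DecidableEq γ] (l : List (Matrix (β × γ) (β × γ) ℂ)) :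
    e23 (α := α) l.prod = (l.map (e23 (α := α))).prod := by
  induction l with
  | nil => simp [e23_one]
  | cons A l ih => simp [e23_mul, ih]

theorem embSite_mul {N : ℕ} (n : Fin N)
    (A B : Matrix (Fin 2 × Fin 2 × Fin 2) (Fin 2 × Fin 2 × Fin 2) ℂ) :
    embSite n (A * B) = embSite n A * embSite n B := by
  ext ⟨a, b, x⟩ ⟨a', b', y⟩
  simp only [embSite, Matrix.mul_apply, Matrix.of_apply, prod_ite_off]
  rw [Finset.sum_mul]
  refine Fintype.sum_of_injective
    (fun k : Fin 2 × Fin 2 × Fin 2 => (k.1, k.2.1, Function.update x n k.2.2)) ?_ _ _ ?_ ?_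
  · rintro ⟨i, j, k⟩ ⟨i', j', k'⟩ h
    simp only [Prod.mk.injEq] at h
    simpa using ⟨h.1, h.2.1, Function.update_injective x n h.2.2⟩
  · rintro ⟨i, j, z⟩ hz
    rw [if_neg (fun h => hz ⟨(i, j, z n), ?_⟩)]
    · simp
    · simp only [Prod.mk.injEq, true_and]
      funext k
      by_cases hk : k = n
      · subst hk; simp
      · simpa [hk] using h k hk
  · rintro ⟨i, j, k⟩
    have h₁ : ∀ l, l ≠ n → x l = Function.update x n k l := by
      intro l hl; simp [hl]
    have h₂ : (∀ l, l ≠ n → Function.update x n k l = y l) ↔ ∀ l, l ≠ n → x l = y l := by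
      refine forall_congr' fun l => forall_congr' fun hl => ?_
      simp [hl]
    simp only [h₂, if_pos h₁, Function.update_self]
    ring

theorem e13_embS {N : ℕ} (n : Fin N) (A : Matrix (Fin 2 × Fin 2) (Fin 2 × Fin 2) ℂ) :
    e13 (β := Fin 2) (embS n A) = embSite n (e13 A) := by
  ext p q
  simp only [e13, embS, embSite, Matrix.of_apply, mul_right_comm]

theorem e23_embS {N : ℕ} (n : Fin N) (A : Matrix (Fin 2 × Fin 2) (Fin 2 × Fin 2) ℂ) :
    e23 (α := Fin 2) (embS n A) = embSite n (e23 A) := by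
  ext p q
  simp only [e23, embS, embSite, Matrix.of_apply, mul_right_comm]

theorem e12_eq_embSite {N : ℕ} (n : Fin N) (A : Matrix (Fin 2 × Fin 2) (Fin 2 × Fin 2) ℂ) :
    e12 (γ := Fin N → Fin 2) A = embSite n (e12 A) := by
  ext ⟨a, b, x⟩ ⟨a', b', y⟩
  simp only [e12, embSite, Matrix.of_apply, prod_ite_off, mul_assoc]
  congr 1
  rw [ite_zero_mul_ite_zero, one_mul]
  congr 1
  rw [funext_iff, eq_iff_iff]
  grind

theorem commute_e13_embS_e23_embS {N : ℕ} {m n : Fin N} (hmn : m ≠ n)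
    (A B : Matrix (Fin 2 × Fin 2) (Fin 2 × Fin 2) ℂ) :
    Commute (e13 (β := Fin 2) (embS m A)) (e23 (α := Fin 2) (embS n B)) := by
  ext ⟨a, b, x⟩ ⟨a', b', y⟩
  simp only [Matrix.mul_apply, e13, e23, embS, Matrix.of_apply, prod_ite_off]
  rw [Finset.sum_eq_single (a', b, Function.update x m (y m)),
    Finset.sum_eq_single (a, b', Function.update x n (y n))]
  · have h₁ : ∀ l, l ≠ m → x l = Function.update x m (y m) l := by
      intro l hl; simp [hl]
    have h₂ : ∀ l, l ≠ n → x l = Function.update x n (y n) l := by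
      intro l hl; simp [hl]
    have h₃ : (∀ l, l ≠ n → Function.update x m (y m) l = y l) ↔
        ∀ l, l ≠ m → Function.update x n (y n) l = y l := by
      simp only [Function.update_apply]
      grind
    simp only [if_pos h₁, if_pos h₂, h₃, Function.update_self, Function.update_of_ne hmn,
      Function.update_of_ne hmn.symm]
    simp
    ring_nf
  · rintro ⟨i, j, z⟩ - hz
    by_contra hne
    simp only [mul_eq_zero, ite_eq_right_iff, one_ne_zero, imp_false, not_or, not_not] at hne
    apply hz
    simp only [Prod.mk.injEq]
    refine ⟨by grind, by grind, ?_⟩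
    funext l
    simp only [Function.update_apply]
    grind
  · simp
  · rintro ⟨i, j, z⟩ - hz
    by_contra hne
    simp only [mul_eq_zero, ite_eq_right_iff, one_ne_zero, imp_false, not_or, not_not] at hne
    apply hz
    simp only [Prod.mk.injEq]
    refine ⟨by grind, by grind, ?_⟩
    funext l
    simp only [Function.update_apply]
    grind
  · simp

/-- A local intertwining relation extends to ordered products of operators at distinct sites. -/
theorem list_prod_intertwine {M ι : Type*} [Monoid M] (R : M) (X Y : ι → M)
    (hRXY : ∀ i, R * X i * Y i = Y i * X i * R)
    (hXY : ∀ i j, i ≠ j → Commute (X i) (Y j)) (l : List ι) (hl : l.Nodup) :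
    R * (l.map X).prod * (l.map Y).prod = (l.map Y).prod * (l.map X).prod * R := by
  induction l with
  | nil => simp
  | cons a l ih =>
    obtain ⟨ha, hl⟩ := List.nodup_cons.mp hl
    have h₁ : Commute (l.map X).prod (Y a) := by
      refine Commute.list_prod_left _ _ fun x hx => ?_
      obtain ⟨i, hi, rfl⟩ := List.mem_map.mp hx
      exact hXY i a fun h => ha (h ▸ hi)
    have h₂ : Commute (X a) (l.map Y).prod := by
      refine Commute.list_prod_right _ _ fun y hy => ?_
      obtain ⟨i, hi, rfl⟩ := List.mem_map.mp hy
      exact hXY a i fun h => ha (h ▸ hi)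
    simp only [List.map_cons, List.prod_cons]
    calc R * (X a * (l.map X).prod) * (Y a * (l.map Y).prod)
        = R * X a * ((l.map X).prod * Y a) * (l.map Y).prod := by simp only [mul_assoc]
      _ = (R * X a * Y a) * (l.map X).prod * (l.map Y).prod := by
          rw [h₁.eq]; simp only [mul_assoc]
      _ = Y a * X a * (R * (l.map X).prod * (l.map Y).prod) := by
          rw [hRXY]; simp only [mul_assoc]
      _ = Y a * (X a * (l.map Y).prod) * (l.map X).prod * R := by
          rw [ih hl]; simp only [mul_assoc]
      _ = Y a * (l.map Y).prod * (X a * (l.map X).prod) * R := by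
          rw [h₂.eq]; simp only [mul_assoc]

set_option maxHeartbeats 1000000 in
/-- The Yang–Baxter equation for six-vertex weights, from the three scalar relations it encodes. -/
theorem Rmat_yang_baxter {b c b' c' b'' c'' : ℂ}
    (h₁ : b' * c'' = b * c'' + c * c' * b'') (h₂ : c' = c * c'' + b * c' * b'')
    (h₃ : c * b' = c * b'' + b * c' * c'') :
    e12 (γ := Fin 2) (Rmat b c) * e13 (β := Fin 2) (Rmat b' c') *
        e23 (α := Fin 2) (Rmat b'' c'') =
      e23 (α := Fin 2) (Rmat b'' c'') * e13 (β := Fin 2) (Rmat b' c') *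
        e12 (γ := Fin 2) (Rmat b c) := by
  ext ⟨p₁, p₂, p₃⟩ ⟨q₁, q₂, q₃⟩
  simp only [e12, e13, e23, Matrix.mul_apply, Matrix.of_apply, Fintype.sum_prod_type, mul_ite,
    ite_mul, mul_one, mul_zero, zero_mul, Finset.sum_ite_eq, Finset.sum_ite_eq', Finset.mem_univ,
    if_true, Finset.sum_ite_irrel, Finset.sum_const_zero]
  fin_cases p₁ <;> fin_cases p₂ <;> fin_cases p₃ <;> fin_cases q₁ <;> fin_cases q₂ <;>
    fin_cases q₃ <;> simp [Rmat] <;> grind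

theorem Rxxz_yang_baxter (η lam mu nu : ℂ) (h : Complex.sinh (lam - mu + η) ≠ 0)
    (hlam : Complex.sinh (lam - nu + η) ≠ 0) (hmu : Complex.sinh (mu - nu + η) ≠ 0) :
    e12 (γ := Fin 2) (Rxxz η lam mu) * e13 (β := Fin 2) (Rxxz η lam nu) *
        e23 (α := Fin 2) (Rxxz η mu nu) =
      e23 (α := Fin 2) (Rxxz η mu nu) * e13 (β := Fin 2) (Rxxz η lam nu) *
        e12 (γ := Fin 2) (Rxxz η lam mu) := by
  obtain ⟨u, rfl⟩ : ∃ u, lam = u + mu := ⟨lam - mu, by ring⟩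
  obtain ⟨v, rfl⟩ : ∃ v, mu = v + nu := ⟨mu - nu, by ring⟩
  have e₁ : u + (v + nu) - (v + nu) = u := by ring
  have e₂ : u + (v + nu) - nu = u + v := by ring
  have e₃ : v + nu - nu = v := by ring
  rw [e₁] at h
  rw [e₂] at hlam
  rw [e₃] at hmu
  unfold Rxxz
  rw [e₁, e₂, e₃]
  have hu := Complex.cosh_sq u
  have hv := Complex.cosh_sq v
  have hη := Complex.cosh_sq η
  apply Rmat_yang_baxter <;> field_simp <;>
    simp only [Complex.sinh_add, Complex.cosh_add] <;> grind

/-- the RTT relation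
`R₁₂(λ,μ) T₁(λ) T₂(μ) = T₂(μ) T₁(λ) R₁₂(λ,μ)` on ℂ²₁ ⊗ ℂ²₂ ⊗ H
for the inhomogeneous XXZ monodromy matrix. -/
theorem xxz_RTT (η : ℂ) (hη : Complex.sinh η ≠ 0) {N : ℕ} (ξ : Fin N → ℂ) (lam mu : ℂ)
    (h : Complex.sinh (lam - mu + η) ≠ 0)
    (hlam : ∀ n : Fin N, Complex.sinh (lam - ξ n + η) ≠ 0)
    (hmu : ∀ n : Fin N, Complex.sinh (mu - ξ n + η) ≠ 0) :
    e12 (γ := Fin N → Fin 2) (Rxxz η lam mu) * e13 (β := Fin 2) (Tmon η ξ lam) *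
        e23 (α := Fin 2) (Tmon η ξ mu) =
      e23 (α := Fin 2) (Tmon η ξ mu) * e13 (β := Fin 2) (Tmon η ξ lam) *
        e12 (γ := Fin N → Fin 2) (Rxxz η lam mu) := by
  have hsite : ∀ n : Fin N,
      e12 (γ := Fin N → Fin 2) (Rxxz η lam mu) * e13 (β := Fin 2) (embS n (Rxxz η lam (ξ n))) *
          e23 (α := Fin 2) (embS n (Rxxz η mu (ξ n))) =
        e23 (α := Fin 2) (embS n (Rxxz η mu (ξ n))) *
          e13 (β := Fin 2) (embS n (Rxxz η lam (ξ n))) *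
          e12 (γ := Fin N → Fin 2) (Rxxz η lam mu) := by
    intro n
    rw [e12_eq_embSite n, e13_embS, e23_embS]
    simp only [← embSite_mul]
    rw [Rxxz_yang_baxter η lam mu (ξ n) h (hlam n) (hmu n)]
  have key := list_prod_intertwine _ _ _ hsite
    (fun _ _ hij => commute_e13_embS_e23_embS hij _ _) (List.finRange N).reverse
    (List.nodup_reverse.mpr (List.nodup_finRange N))
  simpa only [Tmon, e13_list_prod, e23_list_prod, List.ofFn_eq_map, ← List.map_reverse,
    List.map_map, Function.comp_def] using key
end
end

section
/- Assume sinh(ξ_i − ξ_j + η) ≠ 0 for all 1 ≤ i,j ≤ N. Let S^− = [[0,0],[1,0]] be the spin-lowering operator and S^−_n its action on the n-th tensor factor of H (identity elsewhere). Then for every 1 ≤ n ≤ N: (∏_{i=1}^{n−1} (A+D)(ξ_i)) · B(ξ_n) = S^−_n · (∏_{i=1}^{n} (A+D)(ξ_i)); equivalently, if the (A+D)(ξ_i) are invertible, S^−_n = (∏_{i=1}^{n−1} (A+D)(ξ_i)) B(ξ_n) (∏_{i=1}^{n} (A+D)(ξ_i))^{−1}. -/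
open Matrix Complex

noncomputable section

variable {N : ℕ}

section SiteOperators

lemma prod_off_site_update (n : Fin N) (x z : Fin N → Fin 2) :
    (∏ j : Fin N, if j = n then (1 : ℂ) else (if x j = z j then 1 else 0)) =
      if z = Function.update x n (z n) then 1 else 0 := by
  split_ifs with h
  · refine Finset.prod_eq_one fun j _ => ?_
    split_ifs with hj hx
    · rfl
    · rfl
    · exact absurd (by rw [h, Function.update_of_ne hj]) hx
  · obtain ⟨j, hj⟩ := Function.ne_iff.mp h
    have hjn : j ≠ n := by
      rintro rfl
      simp at hj
    rw [Function.update_of_ne hjn] at hj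
    exact Finset.prod_eq_zero (Finset.mem_univ j) (by simp [hjn, Ne.symm hj])

lemma embH_mul_apply (n : Fin N) (M : Matrix (Fin 2) (Fin 2) ℂ)
    (X : Matrix (Fin N → Fin 2) (Fin N → Fin 2) ℂ) (x y : Fin N → Fin 2) :
    (embH n M * X) x y = ∑ a, M (x n) a * X (Function.update x n a) y := by
  have hinj : Function.Injective (fun a : Fin 2 => Function.update x n a) :=
    Function.update_injective x n
  rw [Matrix.mul_apply]
  refine (Finset.sum_of_injOn (fun a => Function.update x n a) hinj.injOn (by simp) ?_ ?_).symm
  · intro z _ hz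
    have : z ≠ Function.update x n (z n) := fun h => hz ⟨z n, by simp, h.symm⟩
    simp only [embH, Matrix.of_apply, prod_off_site_update, if_neg this, mul_zero, zero_mul]
  · intro a _
    simp [embH, prod_off_site_update]

lemma embH_update_apply (n : Fin N) (M : Matrix (Fin 2) (Fin 2) ℂ) (x y : Fin N → Fin 2)
    (a : Fin 2) : embH n M (Function.update x n a) y =
      M a (y n) * ∏ j : Fin N, if j = n then 1 else (if x j = y j then 1 else 0) := by
  simp only [embH, Matrix.of_apply, Function.update_self]
  congr 1
  refine Finset.prod_congr rfl fun j _ => ?_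
  split_ifs <;> simp_all

lemma embH_mul (n : Fin N) (M M' : Matrix (Fin 2) (Fin 2) ℂ) :
    embH n M * embH n M' = embH n (M * M') := by
  ext x y
  simp only [embH_mul_apply, embH_update_apply]
  simp only [embH, Matrix.of_apply, Matrix.mul_apply, Finset.sum_mul, mul_assoc]

lemma embH_one (n : Fin N) : embH n (1 : Matrix (Fin 2) (Fin 2) ℂ) = 1 := by
  rw [← mul_one (embH n 1)]
  ext x y
  simp only [embH_mul_apply, Matrix.one_apply (i := x n), ite_mul, one_mul, zero_mul,
    Finset.sum_ite_eq, Finset.mem_univ, if_true]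
  rw [Function.update_eq_self]

lemma embH_add (n : Fin N) (M M' : Matrix (Fin 2) (Fin 2) ℂ) :
    embH n (M + M') = embH n M + embH n M' := by
  ext x y
  simp [embH, add_mul]

lemma embH_zero (n : Fin N) : embH n (0 : Matrix (Fin 2) (Fin 2) ℂ) = 0 := by
  ext x y
  simp [embH]

lemma embH_commute {m n : Fin N} (h : m ≠ n) (M M' : Matrix (Fin 2) (Fin 2) ℂ) :
    Commute (embH m M) (embH n M') := by
  rw [commute_iff_eq, ← mul_one (embH m M * _), ← mul_one (embH n M' * _)]
  ext x y
  simp only [mul_assoc, embH_mul_apply, Function.update_of_ne h, Function.update_of_ne h.symm,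
    Finset.mul_sum]
  rw [Finset.sum_comm]
  refine Finset.sum_congr rfl fun a _ => Finset.sum_congr rfl fun b _ => ?_
  rw [Function.update_comm h]
  ring

lemma embH_single_mul_single (n : Fin N) (a b c d : Fin 2) :
    embH n (Matrix.single a b 1) * embH n (Matrix.single c d 1) =
      if b = c then embH n (Matrix.single a d 1) else 0 := by
  rw [embH_mul]
  split_ifs with h
  · subst h
    simp
  · rw [Matrix.single_mul_single_of_ne _ _ _ _ h, embH_zero]

lemma embH_single_add_single (n : Fin N) :
    embH n (Matrix.single 0 0 1) + embH n (Matrix.single 1 1 1) = 1 := by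
  rw [← embH_add, ← embH_one n]
  congr 1
  ext i j
  fin_cases i <;> fin_cases j <;> simp

end SiteOperators

section Contraction

/-- The matrix over `End H` representing an operator on (aux) ⊗ (site `n`). -/
def auxBlocks (n : Fin N) (M : Matrix (Fin 2 × Fin 2) (Fin 2 × Fin 2) ℂ) :
    Matrix (Fin 2) (Fin 2) (Matrix (Fin N → Fin 2) (Fin N → Fin 2) ℂ) :=
  fun ε ε' => embH n (Matrix.of fun p q => M (ε, p) (ε', q))

/-- Identification of the auxiliary space with the `n`-th tensor factor of H. -/
def contractAux (n : Fin N)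
    (X : Matrix (Fin 2) (Fin 2) (Matrix (Fin N → Fin 2) (Fin N → Fin 2) ℂ)) :
    Matrix (Fin N → Fin 2) (Fin N → Fin 2) ℂ :=
  ∑ a, ∑ b, embH n (Matrix.single a b 1) * X a b

/-- The operator on H acting as `M` on the factors `i` (first) and `j` (second). -/
def pairOp (i j : Fin N) (M : Matrix (Fin 2 × Fin 2) (Fin 2 × Fin 2) ℂ) :
    Matrix (Fin N → Fin 2) (Fin N → Fin 2) ℂ :=
  contractAux i (auxBlocks j M)

lemma contractAux_one (n : Fin N) : contractAux n 1 = 1 := by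
  simp [contractAux, Fin.sum_univ_two, embH_single_add_single]

lemma embH_single_mul_mul (n : Fin N) {Z : Matrix (Fin N → Fin 2) (Fin N → Fin 2) ℂ}
    (hZ : ∀ M, Commute (embH n M) Z) (W : Matrix (Fin N → Fin 2) (Fin N → Fin 2) ℂ)
    (a b c d : Fin 2) :
    embH n (Matrix.single a b 1) * Z * (embH n (Matrix.single c d 1) * W) =
      if b = c then embH n (Matrix.single a d 1) * (Z * W) else 0 := by
  rw [mul_assoc, ← mul_assoc Z, ← (hZ _).eq, mul_assoc, ← mul_assoc, embH_single_mul_single]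
  split_ifs <;> simp

lemma contractAux_mul (n : Fin N)
    (X Y : Matrix (Fin 2) (Fin 2) (Matrix (Fin N → Fin 2) (Fin N → Fin 2) ℂ))
    (hX : ∀ a b M, Commute (embH n M) (X a b)) :
    contractAux n (X * Y) = contractAux n X * contractAux n Y := by
  have key : ∀ a b c d, embH n (Matrix.single a b 1) * X a b *
      (embH n (Matrix.single c d 1) * Y c d) =
      if b = c then embH n (Matrix.single a d 1) * (X a b * Y c d) else 0 :=
    fun a b c d => embH_single_mul_mul n (hX a b) _ a b c d
  simp only [contractAux, Matrix.mul_apply, Fin.sum_univ_two, mul_add, add_mul, key]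
  simp
  abel

lemma mul_swap_mul_apply (n : Fin N)
    (U V : Matrix (Fin 2) (Fin 2) (Matrix (Fin N → Fin 2) (Fin N → Fin 2) ℂ))
    (hU : ∀ a b M, Commute (embH n M) (U a b)) (hV : ∀ a b M, Commute (embH n M) (V a b))
    (hUV : ∀ a b c d, Commute (U a b) (V c d)) (a b : Fin 2) :
    (U * auxBlocks n (Rmat 0 1) * V) a b =
      contractAux n V * embH n (Matrix.single b a 1) * contractAux n U := by
  have hP : ∀ c d, auxBlocks n (Rmat 0 1) c d = embH n (Matrix.single d c 1) := by
    intro c d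
    unfold auxBlocks
    congr 1
    ext i j
    fin_cases c <;> fin_cases d <;> fin_cases i <;> fin_cases j <;> simp [Rmat]
  have hl : ∀ c d f, U a c * embH n (Matrix.single d c 1) * V d f =
      embH n (Matrix.single d c 1) * (V d f * U a c) := by
    intro c d f
    rw [← (hU a c _).eq, mul_assoc, (hUV a c d f).eq]
  have hr : ∀ c d e f, embH n (Matrix.single c d 1) * V c d * embH n (Matrix.single b a 1) *
      (embH n (Matrix.single e f 1) * U e f) =
      if d = b ∧ a = e then embH n (Matrix.single c f 1) * (V c d * U e f) else 0 := by
    intro c d e f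
    rw [mul_assoc _ (embH n (Matrix.single b a 1)), ← mul_assoc (embH n (Matrix.single b a 1)),
      embH_single_mul_single]
    by_cases h : a = e
    · simp [h, embH_single_mul_mul n (hV c d)]
    · simp [h]
  simp only [contractAux, Matrix.mul_apply, Fin.sum_univ_two, mul_add, add_mul, hP, hl, hr]
  fin_cases a <;> fin_cases b <;> simp <;> abel

lemma contractAux_commute {n : Fin N} {Z : Matrix (Fin N → Fin 2) (Fin N → Fin 2) ℂ}
    {X : Matrix (Fin 2) (Fin 2) (Matrix (Fin N → Fin 2) (Fin N → Fin 2) ℂ)}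
    (h : ∀ M, Commute Z (embH n M)) (hX : ∀ a b, Commute Z (X a b)) :
    Commute Z (contractAux n X) :=
  Commute.sum_right _ _ _ fun _ _ => Commute.sum_right _ _ _ fun _ _ => (h _).mul_right (hX _ _)

lemma embH_commute_pairOp {k i j : Fin N} (hi : k ≠ i) (hj : k ≠ j)
    (M : Matrix (Fin 2) (Fin 2) ℂ) (M' : Matrix (Fin 2 × Fin 2) (Fin 2 × Fin 2) ℂ) :
    Commute (embH k M) (pairOp i j M') :=
  contractAux_commute (fun _ => embH_commute hi _ _) fun _ _ => embH_commute hj _ _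

lemma pairOp_commute_pairOp {i j k l : Fin N} (hik : i ≠ k) (hil : i ≠ l) (hjk : j ≠ k)
    (hjl : j ≠ l) (M M' : Matrix (Fin 2 × Fin 2) (Fin 2 × Fin 2) ℂ) :
    Commute (pairOp i j M) (pairOp k l M') :=
  (contractAux_commute (fun _ => (embH_commute_pairOp hik hil _ _).symm)
    fun _ _ => (embH_commute_pairOp hjk hjl _ _).symm).symm

lemma commute_list_prod_apply {A : Type*} [Ring A] {Z : A} {l : List (Matrix (Fin 2) (Fin 2) A)}
    (h : ∀ X ∈ l, ∀ a b, Commute Z (X a b)) (a b : Fin 2) : Commute Z (l.prod a b) := by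
  induction l generalizing a b with
  | nil =>
    rw [List.prod_nil, Matrix.one_apply]
    split_ifs
    exacts [Commute.one_right _, Commute.zero_right _]
  | cons X l ih =>
    rw [List.prod_cons, Matrix.mul_apply]
    exact Commute.sum_right _ _ _ fun c _ => (h X (by simp) _ _).mul_right
      (ih (fun Y hY => h Y (by simp [hY])) _ _)

lemma contractAux_list_prod (n : Fin N)
    (l : List (Matrix (Fin 2) (Fin 2) (Matrix (Fin N → Fin 2) (Fin N → Fin 2) ℂ)))
    (h : ∀ X ∈ l, ∀ a b M, Commute (embH n M) (X a b)) :
    contractAux n l.prod = (l.map (contractAux n)).prod := by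
  induction l with
  | nil => simp [contractAux_one]
  | cons X l ih =>
    rw [List.prod_cons, contractAux_mul n X _ (h X (by simp)), List.map_cons, List.prod_cons,
      ih fun Y hY => h Y (by simp [hY])]

lemma pairOp_mul_apply {i j : Fin N} (M : Matrix (Fin 2 × Fin 2) (Fin 2 × Fin 2) ℂ)
    (hij : i ≠ j) (X : Matrix (Fin N → Fin 2) (Fin N → Fin 2) ℂ) (x y : Fin N → Fin 2) :
    (pairOp i j M * X) x y = ∑ a, ∑ b, M (x i, x j) (a, b) *
      X (Function.update (Function.update x i a) j b) y := by
  simp only [pairOp, contractAux, auxBlocks, Finset.sum_mul, Matrix.sum_apply, mul_assoc,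
    embH_mul_apply, Function.update_of_ne hij.symm, Matrix.of_apply]
  generalize x i = p
  fin_cases p <;> simp [Fin.sum_univ_two]

lemma pairOp_mul_pairOp_mul_apply {i j : Fin N} (hij : i ≠ j)
    (M M' : Matrix (Fin 2 × Fin 2) (Fin 2 × Fin 2) ℂ)
    (X : Matrix (Fin N → Fin 2) (Fin N → Fin 2) ℂ) (x y : Fin N → Fin 2) :
    (pairOp i j M * (pairOp j i M' * X)) x y = ∑ a, ∑ b, M (x i, x j) (a, b) *
      ∑ d, ∑ c, M' (b, a) (d, c) * X (Function.update (Function.update x i c) j d) y := by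
  rw [pairOp_mul_apply _ hij]
  refine Finset.sum_congr rfl fun a _ => Finset.sum_congr rfl fun b _ => ?_
  rw [pairOp_mul_apply _ hij.symm]
  congr 1
  refine Finset.sum_congr rfl fun d _ => Finset.sum_congr rfl fun c _ => ?_
  have hupd : Function.update (Function.update (Function.update x i a) j d) i c =
      Function.update (Function.update x i c) j d := by
    rw [Function.update_comm hij.symm, Function.update_idem]
  rw [Function.update_idem, hupd, Function.update_self, Function.update_of_ne hij, Function.update_self]

lemma sum_Rmat_mul_sum_Rmat_mul {b c b' c' : ℂ} (hone : b * b' + c * c' = 1)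
    (hzero : b * c' + c * b' = 0) (F : Fin 2 → Fin 2 → ℂ) (p q : Fin 2) :
    (∑ k, ∑ l, Rmat b c (p, q) (k, l) * ∑ n, ∑ m, Rmat b' c' (l, k) (n, m) * F m n) = F p q := by
  fin_cases p <;> fin_cases q <;> simp [Rmat, Fin.sum_univ_two] <;> grind

lemma pairOp_Rmat_mul_pairOp_Rmat {i j : Fin N} (hij : i ≠ j) {b c b' c' : ℂ}
    (hone : b * b' + c * c' = 1) (hzero : b * c' + c * b' = 0) :
    pairOp i j (Rmat b c) * pairOp j i (Rmat b' c') = 1 := by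
  rw [← mul_one (_ * _), mul_assoc]
  ext x y
  rw [pairOp_mul_pairOp_mul_apply hij, sum_Rmat_mul_sum_Rmat_mul hone hzero fun k l =>
    (1 : Matrix (Fin N → Fin 2) (Fin N → Fin 2) ℂ)
      (Function.update (Function.update x i k) j l) y]
  rw [Function.update_eq_self, Function.update_eq_self]

lemma pairOp_Rxxz_mul_pairOp_Rxxz {i j : Fin N} (hij : i ≠ j) {η lam mu : ℂ}
    (h : Complex.sinh (lam - mu + η) ≠ 0) (h' : Complex.sinh (mu - lam + η) ≠ 0) :
    pairOp i j (Rxxz η lam mu) * pairOp j i (Rxxz η mu lam) = 1 := by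
  have hneg : Complex.sinh (mu - lam) = -Complex.sinh (lam - mu) := by
    rw [← Complex.sinh_neg, neg_sub]
  refine pairOp_Rmat_mul_pairOp_Rmat hij ?_ ?_
  · rw [hneg]
    field_simp
    have hcosh : Complex.cosh (mu - lam) = Complex.cosh (lam - mu) := by
      rw [← Complex.cosh_neg, neg_sub]
    rw [Complex.sinh_add, Complex.sinh_add, hneg, hcosh]
    linear_combination (Complex.sinh η ^ 2) * (-Complex.cosh_sq (lam - mu))
      + (Complex.sinh (lam - mu) ^ 2) * Complex.cosh_sq η
  · rw [hneg]
    ring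

end Contraction

section Reconstruction

/-- The reversed product of the operators `R_{ij}(ξ_i, ξ_j)` over `j` in the list `l`. -/
def pairOpProd (η : ℂ) (ξ : Fin N → ℂ) (i : Fin N) (l : List (Fin N)) :
    Matrix (Fin N → Fin 2) (Fin N → Fin 2) ℂ :=
  (l.map fun j => pairOp i j (Rxxz η (ξ i) (ξ j))).reverse.prod

lemma blkT_eq_list_prod (η : ℂ) (ξ : Fin N → ℂ) (ε ε' : Fin 2) (lam : ℂ) :
    blkT η ξ ε ε' lam =
      ((List.finRange N).map fun n => auxBlocks n (Rxxz η lam (ξ n))).reverse.prod ε ε' := by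
  have : (Matrix.compRingEquiv (Fin 2) (Fin N → Fin 2) ℂ).symm (Tmon η ξ lam) =
      ((List.finRange N).map fun n => auxBlocks n (Rxxz η lam (ξ n))).reverse.prod := by
    rw [Tmon, map_list_prod, List.map_reverse, List.ofFn_eq_map, List.map_map]
    rfl
  rw [← this]
  rfl

lemma Rxxz_self {η : ℂ} (hη : Complex.sinh η ≠ 0) (lam : ℂ) : Rxxz η lam lam = Rmat 0 1 := by
  simp [Rxxz, hη]

lemma contractAux_auxBlocks_list_prod (η : ℂ) (ξ : Fin N → ℂ) (n : Fin N) (l : List (Fin N))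
    (hl : ∀ j ∈ l, n ≠ j) :
    contractAux n (l.map fun j => auxBlocks j (Rxxz η (ξ n) (ξ j))).reverse.prod =
      pairOpProd η ξ n l := by
  rw [contractAux_list_prod, pairOpProd, List.map_reverse, List.map_map]
  · rfl
  · simp only [List.mem_reverse, List.mem_map]
    rintro _ ⟨j, hj, rfl⟩ a b M
    exact embH_commute (hl j hj) _ _

lemma finRange_split (n : Fin N) : List.finRange N =
    (List.finRange N).take n ++ n :: (List.finRange N).drop (n + 1) := by
  conv_lhs => rw [← List.take_append_drop n (List.finRange N),
    List.drop_eq_getElem_cons (by simp)]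
  simp

lemma lt_of_mem_take_finRange {n : ℕ} {j : Fin N} (h : j ∈ (List.finRange N).take n) :
    j.val < n := by
  obtain ⟨k, hk, rfl⟩ := List.mem_take_iff_getElem.mp h
  simp at hk ⊢
  omega

lemma le_of_mem_drop_finRange {n : ℕ} {j : Fin N} (h : j ∈ (List.finRange N).drop n) :
    n ≤ j.val := by
  obtain ⟨k, hk, rfl⟩ := List.mem_drop_iff_getElem.mp h
  simp

lemma blkT_inhomogeneity {η : ℂ} (hη : Complex.sinh η ≠ 0) (ξ : Fin N → ℂ) (n : Fin N)
    (ε ε' : Fin 2) :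
    blkT η ξ ε ε' (ξ n) = pairOpProd η ξ n ((List.finRange N).take n) *
      embH n (Matrix.single ε' ε 1) * pairOpProd η ξ n ((List.finRange N).drop (n + 1)) := by
  have hlo : ∀ j ∈ (List.finRange N).take n, j < n := fun j hj => lt_of_mem_take_finRange hj
  have hhi : ∀ j ∈ (List.finRange N).drop (n + 1), n < j := fun j hj => le_of_mem_drop_finRange hj
  have hsplit := finRange_split n
  rw [blkT_eq_list_prod]
  generalize (List.finRange N).take n = lo at *
  generalize (List.finRange N).drop (n + 1) = hi at *
  rw [hsplit, List.map_append, List.map_cons, List.reverse_append, List.reverse_cons, List.prod_append,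
    List.prod_append, List.prod_singleton, Rxxz_self hη, mul_swap_mul_apply,
    contractAux_auxBlocks_list_prod _ _ _ _ fun j hj => (hlo j hj).ne',
    contractAux_auxBlocks_list_prod _ _ _ _ fun j hj => (hhi j hj).ne]
  · intro a b M
    refine commute_list_prod_apply ?_ a b
    simp only [List.mem_reverse, List.mem_map]
    rintro _ ⟨j, hj, rfl⟩ a b
    exact embH_commute (hhi j hj).ne _ _
  · intro a b M
    refine commute_list_prod_apply ?_ a b
    simp only [List.mem_reverse, List.mem_map]
    rintro _ ⟨j, hj, rfl⟩ a b
    exact embH_commute (hlo j hj).ne' _ _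
  · intro a b c d
    refine commute_list_prod_apply ?_ c d
    simp only [List.mem_reverse, List.mem_map]
    rintro _ ⟨k, hk, rfl⟩ c d
    refine (commute_list_prod_apply ?_ a b).symm
    simp only [List.mem_reverse, List.mem_map]
    rintro _ ⟨j, hj, rfl⟩ a b
    exact embH_commute ((hlo k hk).trans (hhi j hj)).ne _ _

lemma tT_inhomogeneity {η : ℂ} (hη : Complex.sinh η ≠ 0) (ξ : Fin N → ℂ) (n : Fin N) :
    tT η ξ (ξ n) = pairOpProd η ξ n ((List.finRange N).take n) *
      pairOpProd η ξ n ((List.finRange N).drop (n + 1)) := by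
  rw [tT, blkT_inhomogeneity hη, blkT_inhomogeneity hη, ← add_mul, ← mul_add,
    embH_single_add_single, mul_one]

lemma list_prod_mul_reverse_prod_cancel {ι A : Type*} [Monoid A] (f g h : ι → A) (l : List ι)
    (hgh : ∀ i ∈ l, g i * h i = 1)
    (hcomm : l.Pairwise fun i j => Commute (h i) (f j)) :
    (l.map fun i => f i * g i).prod * (l.map h).reverse.prod = (l.map f).prod := by
  induction l with
  | nil => simp
  | cons i l ih =>
    rw [List.pairwise_cons] at hcomm
    have hc : Commute (h i) (l.map f).prod := by
      refine Commute.list_prod_right _ _ ?_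
      simp only [List.mem_map]
      rintro _ ⟨j, hj, rfl⟩
      exact hcomm.1 j hj
    have ih' := ih (fun j hj => hgh j (by simp [hj])) hcomm.2
    simp only [List.map_cons, List.prod_cons, List.reverse_cons, List.prod_append,
      List.prod_nil, mul_one]
    rw [mul_assoc, ← mul_assoc (List.prod _) (List.prod _), ih', ← hc.eq, mul_assoc,
      ← mul_assoc (g i), hgh i (by simp), one_mul]

lemma prodT_succ (η : ℂ) (ξ : Fin N → ℂ) (n : Fin N) :
    prodT η ξ (n + 1) n.isLt = prodT η ξ n n.isLt.le * tT η ξ (ξ n) := by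
  rw [prodT, List.ofFn_succ', List.concat_eq_append, List.prod_append, List.prod_singleton]
  rfl

lemma pairOpProd_list_prod_mul {η : ℂ} {ξ : Fin N → ℂ}
    (hreg : ∀ i j : Fin N, Complex.sinh (ξ i - ξ j + η) ≠ 0) (n : Fin N) :
    (((List.finRange N).take n).map fun i =>
      pairOpProd η ξ i ((List.finRange N).drop n)).prod *
        pairOpProd η ξ n ((List.finRange N).take n) =
      (((List.finRange N).take n).map fun i =>
        pairOpProd η ξ i ((List.finRange N).drop (n + 1))).prod := by
  have hdrop : (List.finRange N).drop n = n :: (List.finRange N).drop (n + 1) := by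
    rw [List.drop_eq_getElem_cons (by simp)]
    simp
  have hcons : ∀ i, pairOpProd η ξ i ((List.finRange N).drop n) =
      pairOpProd η ξ i ((List.finRange N).drop (n + 1)) * pairOp i n (Rxxz η (ξ i) (ξ n)) := by
    intro i
    rw [hdrop]
    simp [pairOpProd]
  simp only [hcons]
  refine list_prod_mul_reverse_prod_cancel _ _ _ _ ?_ ?_
  · intro i hi
    have hin : i < n := lt_of_mem_take_finRange hi
    exact pairOp_Rxxz_mul_pairOp_Rxxz hin.ne (hreg _ _) (hreg _ _)
  · have hnd : ((List.finRange N).take n).Nodup := (List.nodup_finRange N).sublist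
      (List.take_sublist _ _)
    refine List.Pairwise.imp_of_mem ?_ hnd
    intro i j hi hj hij
    have hin : i < n := lt_of_mem_take_finRange hi
    have hjn : j < n := lt_of_mem_take_finRange hj
    refine Commute.list_prod_right _ _ ?_
    simp only [List.mem_reverse, List.mem_map]
    rintro _ ⟨k, hk, rfl⟩
    have hnk : n < k := le_of_mem_drop_finRange hk
    exact pairOp_commute_pairOp hjn.ne' hnk.ne hij (hin.trans hnk).ne _ _

lemma prodT_eq_pairOpProd {η : ℂ} (hη : Complex.sinh η ≠ 0) {ξ : Fin N → ℂ}
    (hreg : ∀ i j : Fin N, Complex.sinh (ξ i - ξ j + η) ≠ 0) (n : ℕ) (h : n ≤ N) :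
    prodT η ξ n h = (((List.finRange N).take n).map fun i =>
      pairOpProd η ξ i ((List.finRange N).drop n)).prod := by
  induction n with
  | zero => simp [prodT]
  | succ n ih =>
    have hs := prodT_succ η ξ ⟨n, h⟩
    have hc := pairOpProd_list_prod_mul hreg ⟨n, h⟩
    simp only at hs hc
    have htake : (List.finRange N).take (n + 1) = (List.finRange N).take n ++ [⟨n, h⟩] := by
      rw [← List.take_append_getElem (by simpa using h)]
      simp
    rw [hs, ih, tT_inhomogeneity hη, ← mul_assoc, hc, htake]
    simp

lemma isUnit_prodT {η : ℂ} {ξ : Fin N → ℂ} (hu : ∀ i : Fin N, IsUnit (tT η ξ (ξ i)))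
    (n : ℕ) (h : n ≤ N) : IsUnit (prodT η ξ n h) := by
  induction n with
  | zero => simp [prodT]
  | succ n ih =>
    have hs := prodT_succ η ξ ⟨n, h⟩
    simp only at hs
    rw [hs]
    exact (ih _).mul (hu _)

end Reconstruction

/-- reconstruction of the local spin-lowering operator `S⁻ = [[0,0],[1,0]]`
for the XXZ chain: `(∏_{i=1}^{n−1}(A+D)(ξ_i)) · B(ξ_n) = S⁻_n · (∏_{i=1}^{n}(A+D)(ξ_i))`;
equivalently, if the `(A+D)(ξ_i)` are invertible,
`S⁻_n = (∏_{i=1}^{n−1}(A+D)(ξ_i)) B(ξ_n) (∏_{i=1}^{n}(A+D)(ξ_i))⁻¹`. -/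
theorem xxz_reconstruction_Sminus (η : ℂ) (hη : Complex.sinh η ≠ 0) {N : ℕ} (ξ : Fin N → ℂ)
    (hreg : ∀ i j : Fin N, Complex.sinh (ξ i - ξ j + η) ≠ 0) (n : Fin N) :
    prodT η ξ n.val n.isLt.le * blkT η ξ 0 1 (ξ n) =
        embH n !![0, 0; 1, 0] * prodT η ξ (n.val + 1) n.isLt ∧
      ((∀ i : Fin N, IsUnit (tT η ξ (ξ i))) →
        embH n !![0, 0; 1, 0] =
          prodT η ξ n.val n.isLt.le * blkT η ξ 0 1 (ξ n) *
            (prodT η ξ (n.val + 1) n.isLt)⁻¹) := by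
  have hS : (!![0, 0; 1, 0] : Matrix (Fin 2) (Fin 2) ℂ) = Matrix.single 1 0 1 := by
    ext i j
    fin_cases i <;> fin_cases j <;> simp
  have hmain : prodT η ξ n.val n.isLt.le * blkT η ξ 0 1 (ξ n) =
      embH n !![0, 0; 1, 0] * prodT η ξ (n.val + 1) n.isLt := by
    have hcomm : Commute (embH n (Matrix.single 1 0 1)) (((List.finRange N).take n).map fun i =>
        pairOpProd η ξ i ((List.finRange N).drop (n + 1))).prod := by
      refine Commute.list_prod_right _ _ ?_
      simp only [List.mem_map]
      rintro _ ⟨i, hi, rfl⟩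
      have hin : i < n := lt_of_mem_take_finRange hi
      refine Commute.list_prod_right _ _ ?_
      simp only [List.mem_reverse, List.mem_map]
      rintro _ ⟨k, hk, rfl⟩
      have hnk : n < k := le_of_mem_drop_finRange hk
      exact embH_commute_pairOp hin.ne' hnk.ne _ _
    rw [hS, prodT_succ, prodT_eq_pairOpProd hη hreg, blkT_inhomogeneity hη, tT_inhomogeneity hη]
    have hE := pairOpProd_list_prod_mul hreg n
    simp only [← mul_assoc]
    rw [hE, ← hcomm.eq, ← hE]
    simp only [mul_assoc]
  refine ⟨hmain, fun hu => ?_⟩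
  have hdet := (Matrix.isUnit_iff_isUnit_det _).mp (isUnit_prodT hu (n.val + 1) n.isLt)
  rw [hmain, Matrix.mul_nonsing_inv_cancel_right _ _ hdet]
end
end
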